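/- Assume W satisfies (W1) with exponent β > 0 and let α > β. Let u ∈ L¹(T²) and let u_n ∈ L¹(T²) and N_n ∈ ℕ be sequences such that u_n → u in L¹(T²) and N_n → ∞. Then h_{∞,0}(u) ≤ liminf_{n→∞} h_{N_n}^α(u_n). -/

import Mathlib

open MeasureTheory Filter Topology ENNReal
open scoped Classical

noncomputable section

/-- Fundamental domain of the flat unit torus `T²`, identified with `[0,1)²`. -/
def Q2 : Set (ℝ × ℝ) := Set.Ico (0:ℝ) 1 ×ˢ Set.Ico (0:ℝ) 1

/-- Lebesgue measure on the torus, realized as Lebesgue measure on the fundamental domain. -/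
def μT : Measure (ℝ × ℝ) := volume.restrict Q2

/-- A function on `ℝ²` represents a function on the torus `T²` iff it is `1`-periodic in
each coordinate. -/
def Periodic2 {E : Type*} (f : ℝ × ℝ → E) : Prop :=
  ∀ x : ℝ × ℝ, f (x.1 + 1, x.2) = f x ∧ f (x.1, x.2 + 1) = f x

/-- The index of the grid square (of the `N × N` grid) a real number's fractional part lies in. -/
def gridIdx (N : ℕ) (t : ℝ) : ℕ := (⌊Int.fract t * N⌋).toNat

/-- The piecewise constant (on the squares `S_N^{i,j}`) extension of grid values `g` to the torus. -/
def extendGrid (N : ℕ) (g : ℕ → ℕ → ℝ) : ℝ × ℝ → ℝ :=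
  fun x => g (gridIdx N x.1) (gridIdx N x.2)

/-- `g` represents `u ∈ A_N`: `u` agrees a.e. with the piecewise constant extension of `g`. -/
def RepGrid (N : ℕ) (u : ℝ × ℝ → ℝ) (g : ℕ → ℕ → ℝ) : Prop :=
  u =ᵐ[μT] extendGrid N g

/-- Binary ({0,1}-valued) grid functions. -/
def IsBinaryGrid (N : ℕ) (g : ℕ → ℕ → ℝ) : Prop :=
  ∀ i < N, ∀ j < N, g i j = 0 ∨ g i j = 1

/-- Convergence in `L¹(T²)`. -/
def TendstoL1 (U : ℕ → ℝ × ℝ → ℝ) (u : ℝ × ℝ → ℝ) : Prop :=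
  Tendsto (fun n => ∫⁻ x, ENNReal.ofReal |U n x - u x| ∂μT) atTop (nhds 0)

/-- The divergence of a vector field on `ℝ²`. -/
def div2 (v : ℝ × ℝ → ℝ × ℝ) (x : ℝ × ℝ) : ℝ :=
  (fderiv ℝ v x (1, 0)).1 + (fderiv ℝ v x (0, 1)).2

/-- The (isotropic) total variation `∫_{T²} |∇u|` of `u ∈ L¹(T²)`, as supremum over `C¹`
periodic vector fields with Euclidean norm at most 1. -/
def isoTV (u : ℝ × ℝ → ℝ) : ℝ≥0∞ :=
  ⨆ (v : ℝ × ℝ → ℝ × ℝ) (_ : ContDiff ℝ 1 v ∧ Periodic2 v ∧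
      ∀ x, (v x).1 ^ 2 + (v x).2 ^ 2 ≤ 1),
    ENNReal.ofReal (∫ x, u x * div2 v x ∂μT)

/-- The anisotropic total variation `∫_{T²} |u_x| + |u_y|`, as supremum over `C¹` periodic
vector fields with max-norm at most 1. -/
def anisoTV (u : ℝ × ℝ → ℝ) : ℝ≥0∞ :=
  ⨆ (v : ℝ × ℝ → ℝ × ℝ) (_ : ContDiff ℝ 1 v ∧ Periodic2 v ∧
      ∀ x, |(v x).1| ≤ 1 ∧ |(v x).2| ≤ 1),
    ENNReal.ofReal (∫ x, u x * div2 v x ∂μT)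

/-- `u ∈ BV(T²; {0,1})`: `u` takes values in `{0,1}` a.e. and has finite total variation. -/
def BV01 (u : ℝ × ℝ → ℝ) : Prop :=
  AEStronglyMeasurable u μT ∧ (∀ᵐ x ∂μT, u x = 0 ∨ u x = 1) ∧ isoTV u < ⊤

/-- The grid cut energy of `h_{N,0}`. -/
def hEnergy (N : ℕ) (g : ℕ → ℕ → ℝ) : ℝ :=
  (N : ℝ)⁻¹ * ∑ i ∈ Finset.range N, ∑ j ∈ Finset.range N,
    (|g ((i + 1) % N) j - g i j| + |g i ((j + 1) % N) - g i j|)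

/-- The functional `h_{N,0} : L¹(T²) → [0,∞]`. -/
def hN0 (N : ℕ) (u : ℝ × ℝ → ℝ) : ℝ≥0∞ :=
  ⨅ (g : ℕ → ℕ → ℝ) (_ : RepGrid N u g ∧ IsBinaryGrid N g), ENNReal.ofReal (hEnergy N g)

/-- The limit functional `h_{∞,0}`: the anisotropic total variation on `BV(T²;{0,1})`,
`+∞` otherwise. -/
def hInf0 (u : ℝ × ℝ → ℝ) : ℝ≥0∞ := if BV01 u then anisoTV u else ⊤

/-- The standing assumptions on the double well potential `W`: `C²`, nonnegative,
vanishing exactly at `0` and `1`. -/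
def DoubleWell (W : ℝ → ℝ) : Prop :=
  ContDiff ℝ 2 W ∧ (∀ s, 0 ≤ W s) ∧ ∀ s, W s = 0 ↔ s = 0 ∨ s = 1

/-- Assumption `(W1)` with exponent `β`: `W` is strictly smaller on neighborhoods
`Î₀ = (a₀,b₀) ∋ 0`, `Î₁ = (a₁,b₁) ∋ 1` of its wells than outside, and has polynomial
lower bounds of order `β` near the wells. -/
def CondW1 (W : ℝ → ℝ) (β : ℝ) : Prop :=
  ∃ a₀ b₀ a₁ b₁ : ℝ, a₀ < 0 ∧ 0 < b₀ ∧ a₁ < 1 ∧ 1 < b₁ ∧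
    Disjoint (Set.Ioo a₀ b₀) (Set.Ioo a₁ b₁) ∧
    (∀ s ∈ Set.Ioo a₀ b₀ ∪ Set.Ioo a₁ b₁, ∀ t ∉ Set.Ioo a₀ b₀ ∪ Set.Ioo a₁ b₁, W s < W t) ∧
    (∃ c₀ > (0:ℝ), ∀ s ∈ Set.Ioo a₀ b₀, c₀ * |s| ^ β ≤ W s) ∧
    (∃ c₁ > (0:ℝ), ∀ s ∈ Set.Ioo a₁ b₁, c₁ * |s - 1| ^ β ≤ W s)

/-- The grid energy of `h_N^α`. -/
def hAlphaEnergy (W : ℝ → ℝ) (α : ℝ) (N : ℕ) (g : ℕ → ℕ → ℝ) : ℝ :=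
  (N : ℝ)⁻¹ * ∑ i ∈ Finset.range N, ∑ j ∈ Finset.range N,
      ((g ((i + 1) % N) j - g i j) ^ 2 + (g i ((j + 1) % N) - g i j) ^ 2)
    + (N : ℝ) ^ α * ∑ i ∈ Finset.range N, ∑ j ∈ Finset.range N, W (g i j)

/-- The functional `h_N^α : L¹(T²) → [0,∞]` (finite exactly on `A_N`). -/
def hNalpha (W : ℝ → ℝ) (α : ℝ) (N : ℕ) (u : ℝ × ℝ → ℝ) : ℝ≥0∞ :=
  ⨅ (g : ℕ → ℕ → ℝ) (_ : RepGrid N u g), ENNReal.ofReal (hAlphaEnergy W α N g)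

theorem gridIdx_eq {N i : ℕ} (hi : i < N) {x : ℝ} (h1 : (i : ℝ) / N ≤ x)
    (h2 : x < ((i + 1 : ℕ) : ℝ) / N) : gridIdx N x = i := by
  have hN : (0 : ℝ) < N := by exact_mod_cast (Nat.zero_le i).trans_lt hi
  have hx0 : 0 ≤ x := le_trans (by positivity) h1
  have hx1 : x < 1 := by
    refine h2.trans_le ((div_le_one hN).2 ?_)
    exact_mod_cast hi
  rw [div_le_iff₀ hN] at h1
  rw [lt_div_iff₀ hN] at h2
  have : ⌊Int.fract x * N⌋ = (i : ℤ) := by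
    rw [Int.fract_eq_self.2 ⟨hx0, hx1⟩, Int.floor_eq_iff]
    push_cast at h2 ⊢
    exact ⟨h1, h2⟩
  simp [gridIdx, this]

theorem gridIdx_lt {N : ℕ} (hN : 0 < N) (t : ℝ) : gridIdx N t < N := by
  have hN' : (0 : ℝ) < N := by exact_mod_cast hN
  have h : ⌊Int.fract t * N⌋ < (N : ℤ) := by
    rw [Int.floor_lt]
    push_cast
    nlinarith [Int.fract_lt_one t]
  unfold gridIdx
  omega

theorem measurable_gridIdx (N : ℕ) : Measurable (gridIdx N) := by
  have h : Measurable fun t : ℝ => ⌊Int.fract t * N⌋ :=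
    Int.measurable_floor.comp (measurable_fract.mul_const _)
  exact (measurable_of_countable Int.toNat).comp h

theorem measurable_extendGrid (N : ℕ) (g : ℕ → ℕ → ℝ) : Measurable (extendGrid N g) := by
  have h : Measurable fun x : ℝ × ℝ => (gridIdx N x.1, gridIdx N x.2) :=
    ((measurable_gridIdx N).comp measurable_fst).prodMk
      ((measurable_gridIdx N).comp measurable_snd)
  exact (measurable_of_countable fun p : ℕ × ℕ => g p.1 p.2).comp h

/-- The integral of a step function on the grid of size `N` against a continuous function. -/
theorem integral_gridIdx_mul {N : ℕ} (hN : 0 < N) (a : ℕ → ℝ) {h : ℝ → ℝ} (hh : Continuous h) :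
    ∫ x in (0 : ℝ)..1, a (gridIdx N x) * h x =
      ∑ i ∈ Finset.range N, a i * ∫ x in ((i : ℝ) / N)..(((i + 1 : ℕ) : ℝ) / N), h x := by
  have hN' : (0 : ℝ) < N := by exact_mod_cast hN
  have hae : ∀ i < N, ∀ᵐ x ∂volume, x ∈ Set.uIoc ((i : ℝ) / N) (((i + 1 : ℕ) : ℝ) / N) →
      a (gridIdx N x) * h x = a i * h x := by
    intro i hi
    have hle : (i : ℝ) / N ≤ ((i + 1 : ℕ) : ℝ) / N := by
      gcongr
      exact Nat.le_succ i
    filter_upwards [Measure.ae_ne volume (((i + 1 : ℕ) : ℝ) / N)] with x hx hmem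
    rw [Set.uIoc_of_le hle] at hmem
    rw [gridIdx_eq hi hmem.1.le (lt_of_le_of_ne hmem.2 hx)]
  have hsum := intervalIntegral.sum_integral_adjacent_intervals
    (f := fun x => a (gridIdx N x) * h x) (μ := volume) (a := fun i : ℕ => (i : ℝ) / N) (n := N)
    (fun i hi => by
      refine IntervalIntegrable.congr_ae (f := fun x => a i * h x)
        ((hh.const_mul (a i)).intervalIntegrable _ _) ?_
      rw [Filter.EventuallyEq, ae_restrict_iff' measurableSet_uIoc]
      filter_upwards [hae i hi] with x hx hm using (hx hm).symm)
  simp only [Nat.cast_zero, zero_div, div_self hN'.ne'] at hsum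
  rw [← hsum]
  refine Finset.sum_congr rfl fun i hi => ?_
  rw [← intervalIntegral.integral_const_mul]
  exact intervalIntegral.integral_congr_ae (hae i (Finset.mem_range.1 hi))

/-- Discrete integration by parts for periodic step functions of one variable. -/
theorem integral_gridIdx_mul_deriv_le {N : ℕ} (hN : 0 < N) (a : ℕ → ℝ) {f f' : ℝ → ℝ}
    (hf : ∀ x, HasDerivAt f (f' x) x) (hf' : Continuous f') (hper : f 1 = f 0)
    (hb : ∀ x, |f x| ≤ 1) :
    ∫ x in (0 : ℝ)..1, a (gridIdx N x) * f' x ≤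
      ∑ i ∈ Finset.range N, |a ((i + 1) % N) - a i| := by
  have hN' : (N : ℝ) ≠ 0 := by exact_mod_cast hN.ne'
  rw [integral_gridIdx_mul hN a hf']
  have hint : ∀ i : ℕ, ∫ x in ((i : ℝ) / N)..(((i + 1 : ℕ) : ℝ) / N), f' x =
      f (((i + 1 : ℕ) : ℝ) / N) - f ((i : ℝ) / N) := fun i =>
    intervalIntegral.integral_eq_sub_of_hasDerivAt (fun x _ => hf x) (hf'.intervalIntegrable _ _)
  have htel : ∑ i ∈ Finset.range N,
      (a ((i + 1) % N) * f (((i + 1 : ℕ) : ℝ) / N) - a (i % N) * f ((i : ℝ) / N)) = 0 := by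
    rw [Finset.sum_range_sub (fun i : ℕ => a (i % N) * f ((i : ℝ) / N))]
    simp [div_self hN', hper]
  rw [← sub_zero (∑ i ∈ Finset.range N, _ * _), ← htel, ← Finset.sum_sub_distrib]
  refine Finset.sum_le_sum fun i hi => ?_
  rw [hint, Nat.mod_eq_of_lt (Finset.mem_range.1 hi)]
  calc _ = (a i - a ((i + 1) % N)) * f (((i + 1 : ℕ) : ℝ) / N) := by ring
    _ ≤ |a i - a ((i + 1) % N)| * |f (((i + 1 : ℕ) : ℝ) / N)| := by
      rw [← abs_mul]
      exact le_abs_self _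
    _ ≤ |a i - a ((i + 1) % N)| := mul_le_of_le_one_right (abs_nonneg _) (hb _)
    _ = _ := abs_sub_comm _ _

theorem integral_gridIdx {N : ℕ} (hN : 0 < N) (a : ℕ → ℝ) :
    ∫ x in (0 : ℝ)..1, a (gridIdx N x) = (N : ℝ)⁻¹ * ∑ i ∈ Finset.range N, a i := by
  have h := integral_gridIdx_mul hN a (h := fun _ => 1) continuous_const
  simp only [mul_one] at h
  rw [h, Finset.mul_sum]
  refine Finset.sum_congr rfl fun i _ => ?_
  have hN' : (N : ℝ) ≠ 0 := by exact_mod_cast hN.ne'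
  simp
  field_simp
  ring

theorem μT_eq_prod : μT = ((volume : Measure ℝ).restrict (Set.Ico 0 1)).prod
    ((volume : Measure ℝ).restrict (Set.Ico 0 1)) := by
  rw [Measure.prod_restrict]
  rfl

instance : IsFiniteMeasure μT := by
  rw [μT_eq_prod]
  infer_instance

theorem μT_univ : μT Set.univ = 1 := by
  rw [μT_eq_prod, ← Set.univ_prod_univ, Measure.prod_prod]
  simp

theorem setIntegral_Ico_eq_intervalIntegral (f : ℝ → ℝ) :
    ∫ x in Set.Ico (0 : ℝ) 1, f x = ∫ x in (0 : ℝ)..1, f x := by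
  rw [intervalIntegral.integral_of_le zero_le_one, integral_Ico_eq_integral_Ioc]

theorem exists_bound_of_continuous {f : ℝ × ℝ → ℝ} (hf : Continuous f) :
    ∃ M : ℝ, 0 ≤ M ∧ ∀ᵐ x ∂μT, |f x| ≤ M := by
  obtain ⟨M, hM⟩ := ((isCompact_Icc (a := (0 : ℝ)) (b := 1)).prod
    (isCompact_Icc (a := (0 : ℝ)) (b := 1))).exists_bound_of_continuousOn hf.continuousOn
  refine ⟨max M 0, le_max_right _ _, ?_⟩
  have hQ : MeasurableSet Q2 := measurableSet_Ico.prod measurableSet_Ico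
  filter_upwards [ae_restrict_mem hQ] with x hx
  exact (hM x ⟨Set.Ico_subset_Icc_self hx.1, Set.Ico_subset_Icc_self hx.2⟩).trans
    (le_max_left _ _)

theorem integrable_extendGrid_mul {N : ℕ} {g : ℕ → ℕ → ℝ} (hg : ∀ i j, |g i j| ≤ 1)
    {f : ℝ × ℝ → ℝ} (hf : Continuous f) :
    Integrable (fun x => extendGrid N g x * f x) μT := by
  obtain ⟨M, hM0, hM⟩ := exists_bound_of_continuous hf
  refine Integrable.of_bound
    ((measurable_extendGrid N g).mul hf.measurable).aestronglyMeasurable M ?_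
  filter_upwards [hM] with x hx
  rw [Real.norm_eq_abs, abs_mul]
  calc _ ≤ 1 * M := mul_le_mul (hg _ _) hx (abs_nonneg _) zero_le_one
    _ = M := one_mul M

/-- An iterated integral is bounded by the average of the bounds on the grid lines. -/
theorem setIntegral_Ico_le_of_gridIdx_le {N : ℕ} (hN : 0 < N) {F : ℝ → ℝ} {a : ℕ → ℝ}
    (hF : Integrable F (volume.restrict (Set.Ico 0 1))) (h : ∀ y, F y ≤ a (gridIdx N y)) :
    ∫ y in Set.Ico (0 : ℝ) 1, F y ≤ (N : ℝ)⁻¹ * ∑ j ∈ Finset.range N, a j := by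
  rw [← integral_gridIdx hN, ← setIntegral_Ico_eq_intervalIntegral]
  refine integral_mono hF ?_ h
  obtain ⟨M, hM⟩ := ((Finset.range N).image fun j => |a j|).exists_le
  refine Integrable.of_bound ((measurable_of_countable a).comp
    (measurable_gridIdx N)).aestronglyMeasurable M (ae_of_all _ fun y => ?_)
  exact hM _ (Finset.mem_image.2 ⟨_, Finset.mem_range.2 (gridIdx_lt hN y), rfl⟩)

section VectorField

variable {v : ℝ × ℝ → ℝ × ℝ}

theorem hasDerivAt_fst_comp (hv : ContDiff ℝ 1 v) (x y : ℝ) :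
    HasDerivAt (fun s => (v (s, y)).1) (fderiv ℝ v (x, y) (1, 0)).1 x := by
  have h := ((hv.differentiable one_ne_zero) (x, y)).hasFDerivAt.comp_hasDerivAt x
    ((hasDerivAt_id x).prodMk (hasDerivAt_const x y))
  exact (ContinuousLinearMap.fst ℝ ℝ ℝ).hasFDerivAt.comp_hasDerivAt x h

theorem hasDerivAt_snd_comp (hv : ContDiff ℝ 1 v) (x y : ℝ) :
    HasDerivAt (fun s => (v (x, s)).2) (fderiv ℝ v (x, y) (0, 1)).2 y := by
  have h := ((hv.differentiable one_ne_zero) (x, y)).hasFDerivAt.comp_hasDerivAt y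
    ((hasDerivAt_const y x).prodMk (hasDerivAt_id y))
  exact (ContinuousLinearMap.snd ℝ ℝ ℝ).hasFDerivAt.comp_hasDerivAt y h

theorem continuous_fderiv_fst (hv : ContDiff ℝ 1 v) :
    Continuous fun x => (fderiv ℝ v x (1, 0)).1 :=
  ((hv.continuous_fderiv one_ne_zero).clm_apply continuous_const).fst

theorem continuous_fderiv_snd (hv : ContDiff ℝ 1 v) :
    Continuous fun x => (fderiv ℝ v x (0, 1)).2 :=
  ((hv.continuous_fderiv one_ne_zero).clm_apply continuous_const).snd

theorem continuous_div2 (hv : ContDiff ℝ 1 v) : Continuous (div2 v) :=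
  (continuous_fderiv_fst hv).add (continuous_fderiv_snd hv)

/-- Discrete integration by parts: the anisotropic total variation of a grid function is
at most its cut energy. -/
theorem integral_extendGrid_mul_div2_le {N : ℕ} (hN : 0 < N) {g : ℕ → ℕ → ℝ}
    (hg : ∀ i j, |g i j| ≤ 1) (hv : ContDiff ℝ 1 v) (hper : Periodic2 v)
    (hb : ∀ x, |(v x).1| ≤ 1 ∧ |(v x).2| ≤ 1) :
    ∫ x, extendGrid N g x * div2 v x ∂μT ≤ hEnergy N g := by
  have i1 := integrable_extendGrid_mul (N := N) hg (continuous_fderiv_fst hv)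
  have i2 := integrable_extendGrid_mul (N := N) hg (continuous_fderiv_snd hv)
  have hsplit : ∫ x, extendGrid N g x * div2 v x ∂μT =
      ∫ x, extendGrid N g x * (fderiv ℝ v x (1, 0)).1 ∂μT +
        ∫ x, extendGrid N g x * (fderiv ℝ v x (0, 1)).2 ∂μT := by
    rw [← integral_add i1 i2]
    simp only [div2, mul_add]
  rw [μT_eq_prod] at i1 i2
  have h1 : ∫ x, extendGrid N g x * (fderiv ℝ v x (1, 0)).1 ∂μT ≤
      (N : ℝ)⁻¹ * ∑ j ∈ Finset.range N, ∑ i ∈ Finset.range N, |g ((i + 1) % N) j - g i j| := by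
    rw [μT_eq_prod, integral_prod_symm _ i1]
    refine setIntegral_Ico_le_of_gridIdx_le hN i1.integral_prod_right fun y => ?_
    rw [setIntegral_Ico_eq_intervalIntegral]
    refine integral_gridIdx_mul_deriv_le hN (fun i => g i (gridIdx N y))
      (f := fun s => (v (s, y)).1) (f' := fun s => (fderiv ℝ v (s, y) (1, 0)).1)
      (fun x => hasDerivAt_fst_comp hv x y)
      ((continuous_fderiv_fst hv).comp (by fun_prop)) ?_ fun x => (hb _).1
    have := (hper (0, y)).1
    simp only [zero_add] at this
    simp only [this]
  have h2 : ∫ x, extendGrid N g x * (fderiv ℝ v x (0, 1)).2 ∂μT ≤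
      (N : ℝ)⁻¹ * ∑ i ∈ Finset.range N, ∑ j ∈ Finset.range N, |g i ((j + 1) % N) - g i j| := by
    rw [μT_eq_prod, integral_prod _ i2]
    refine setIntegral_Ico_le_of_gridIdx_le hN i2.integral_prod_left fun x => ?_
    rw [setIntegral_Ico_eq_intervalIntegral]
    refine integral_gridIdx_mul_deriv_le hN (fun j => g (gridIdx N x) j)
      (f := fun s => (v (x, s)).2) (f' := fun s => (fderiv ℝ v (x, s) (0, 1)).2)
      (fun y => hasDerivAt_snd_comp hv x y)
      ((continuous_fderiv_snd hv).comp (by fun_prop)) ?_ fun y => (hb _).2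
    have := (hper (x, 0)).2
    simp only [zero_add] at this
    simp only [this]
  rw [hsplit, hEnergy]
  simp only [Finset.sum_add_distrib, mul_add]
  rw [Finset.sum_comm] at h1
  exact add_le_add h1 h2

end VectorField

theorem isoTV_le_anisoTV (u : ℝ × ℝ → ℝ) : isoTV u ≤ anisoTV u := by
  refine iSup₂_le fun v hv => ?_
  refine le_iSup₂_of_le v ⟨hv.1, hv.2.1, fun x => ⟨?_, ?_⟩⟩ le_rfl
  · exact (sq_le_one_iff_abs_le_one _).1 (by nlinarith [hv.2.2 x, sq_nonneg (v x).2])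
  · exact (sq_le_one_iff_abs_le_one _).1 (by nlinarith [hv.2.2 x, sq_nonneg (v x).1])

/-- Small values of the potential are only attained near the wells. -/
theorem CondW1.exists_near_wells {W : ℝ → ℝ} {β : ℝ} (h : CondW1 W β) (hW : DoubleWell W)
    (hβ : 0 < β) {ε : ℝ} (hε : 0 < ε) :
    ∃ m > 0, ∀ s, W s < m → |s| < ε ∨ |s - 1| < ε := by
  obtain ⟨a₀, b₀, a₁, b₁, ha₀, hb₀, ha₁, hb₁, hdisj, hout, ⟨c₀, hc₀, h₀⟩, ⟨c₁, hc₁, h₁⟩⟩ := h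
  have hmem : b₀ / 2 ∈ Set.Ioo a₀ b₀ := ⟨by linarith, by linarith⟩
  have hpos : 0 < W (b₀ / 2) := by
    refine lt_of_le_of_ne (hW.2.1 _) fun h0 => ?_
    rcases (hW.2.2 _).1 h0.symm with h | h
    · linarith
    · exact Set.disjoint_left.1 hdisj hmem (h ▸ ⟨ha₁, hb₁⟩)
  have hεβ : 0 < ε ^ β := Real.rpow_pos_of_pos hε β
  refine ⟨min (W (b₀ / 2)) (min (c₀ * ε ^ β) (c₁ * ε ^ β)), by positivity, fun s hs => ?_⟩
  obtain ⟨hs1, hs2, hs3⟩ : W s < W (b₀ / 2) ∧ W s < c₀ * ε ^ β ∧ W s < c₁ * ε ^ β := by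
    simpa using hs
  by_cases hsI : s ∈ Set.Ioo a₀ b₀ ∪ Set.Ioo a₁ b₁
  · rcases hsI with hsI | hsI
    · left
      have := (h₀ s hsI).trans_lt hs2
      exact (Real.rpow_lt_rpow_iff (abs_nonneg _) hε.le hβ).1 (lt_of_mul_lt_mul_left this hc₀.le)
    · right
      have := (h₁ s hsI).trans_lt hs3
      exact (Real.rpow_lt_rpow_iff (abs_nonneg _) hε.le hβ).1 (lt_of_mul_lt_mul_left this hc₁.le)
  · exact absurd (hout _ (Or.inl hmem) s hsI) hs1.not_gt

/-- Rounding to the nearest well. -/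
def roundWell (s : ℝ) : ℝ := if s < 1 / 2 then 0 else 1

theorem roundWell_eq (s : ℝ) : roundWell s = 0 ∨ roundWell s = 1 := by
  unfold roundWell
  split_ifs <;> simp

theorem abs_roundWell_le (s : ℝ) : |roundWell s| ≤ 1 := by
  rcases roundWell_eq s with h | h <;> simp [h]

theorem abs_sub_roundWell_le {ε s : ℝ} (hε : ε < 1 / 2) (hs : |s| < ε ∨ |s - 1| < ε) :
    |s - roundWell s| ≤ ε := by
  unfold roundWell
  rw [abs_lt, abs_lt] at hs
  split_ifs with h <;> rw [abs_le] <;> constructor <;> rcases hs with hs | hs <;> linarith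

theorem mul_abs_roundWell_sub_le {ε s t : ℝ} (hε : ε < 1 / 2)
    (hs : |s - roundWell s| ≤ ε) (ht : |t - roundWell t| ≤ ε) :
    (1 - 2 * ε) ^ 2 * |roundWell t - roundWell s| ≤ (t - s) ^ 2 := by
  rw [abs_le] at hs ht
  rcases roundWell_eq s with h | h <;> rcases roundWell_eq t with h' | h' <;>
    rw [h] at hs ⊢ <;> rw [h'] at ht ⊢ <;> norm_num
  · exact sq_nonneg _
  · apply sq_le_sq' <;> linarith
  · rw [← neg_sub s t, neg_sq]
    apply sq_le_sq' <;> linarith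
  · exact sq_nonneg _

theorem mul_hEnergy_roundWell_le {N : ℕ} {g : ℕ → ℕ → ℝ} {ε : ℝ} (hN : 0 < N) (hε : ε < 1 / 2)
    (hg : ∀ i < N, ∀ j < N, |g i j - roundWell (g i j)| ≤ ε) {W : ℝ → ℝ} (hW : ∀ s, 0 ≤ W s)
    (α : ℝ) :
    (1 - 2 * ε) ^ 2 * hEnergy N (fun i j => roundWell (g i j)) ≤ hAlphaEnergy W α N g := by
  have hpot : 0 ≤ (N : ℝ) ^ α * ∑ i ∈ Finset.range N, ∑ j ∈ Finset.range N, W (g i j) :=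
    mul_nonneg (by positivity)
      (Finset.sum_nonneg fun _ _ => Finset.sum_nonneg fun _ _ => hW _)
  refine le_trans ?_ (le_add_of_nonneg_right hpot)
  rw [hEnergy, mul_left_comm]
  refine mul_le_mul_of_nonneg_left ?_ (by positivity)
  rw [Finset.mul_sum]
  refine Finset.sum_le_sum fun i hi => ?_
  rw [Finset.mul_sum]
  refine Finset.sum_le_sum fun j hj => ?_
  rw [Finset.mem_range] at hi hj
  rw [mul_add]
  exact add_le_add
    (mul_abs_roundWell_sub_le hε (hg i hi j hj) (hg _ (Nat.mod_lt _ hN) j hj))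
    (mul_abs_roundWell_sub_le hε (hg i hi j hj) (hg i hi _ (Nat.mod_lt _ hN)))

theorem rpow_mul_le_hAlphaEnergy {W : ℝ → ℝ} (hW : ∀ s, 0 ≤ W s) (α : ℝ) {N i j : ℕ}
    (hi : i < N) (hj : j < N) (g : ℕ → ℕ → ℝ) :
    (N : ℝ) ^ α * W (g i j) ≤ hAlphaEnergy W α N g := by
  refine le_trans ?_ (le_add_of_nonneg_left (mul_nonneg (by positivity)
    (Finset.sum_nonneg fun _ _ => Finset.sum_nonneg fun _ _ => by positivity)))
  refine mul_le_mul_of_nonneg_left ?_ (by positivity)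
  exact (Finset.single_le_sum (f := fun j => W (g i j)) (fun _ _ => hW _)
    (Finset.mem_range.2 hj)).trans (Finset.single_le_sum
      (f := fun i => ∑ j ∈ Finset.range N, W (g i j))
      (fun _ _ => Finset.sum_nonneg fun _ _ => hW _) (Finset.mem_range.2 hi))

/-- If the energies of an `L¹`-convergent sequence are frequently below `C`, then the limit is
`L¹`-close to binary grid functions whose cut energy is almost at most `C`. -/
theorem exists_binary_grid_approx {W : ℝ → ℝ} (hW : DoubleWell W) {β : ℝ} (hβ : 0 < β)
    (hW1 : CondW1 W β) {α : ℝ} (hα : β < α) {u : ℝ × ℝ → ℝ} (hu : Integrable u μT)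
    {U : ℕ → ℝ × ℝ → ℝ} (hU : ∀ n, Integrable (U n) μT) {Nn : ℕ → ℕ}
    (hNn : Tendsto Nn atTop atTop) (hconv : TendstoL1 U u) {C : ℝ}
    (hC : ∃ᶠ n in atTop, hNalpha W α (Nn n) (U n) < ENNReal.ofReal C)
    {ε : ℝ} (hε : 0 < ε) (hε' : ε < 1 / 2) :
    ∃ (N : ℕ) (r : ℕ → ℕ → ℝ), 0 < N ∧ (∀ i j, r i j = 0 ∨ r i j = 1) ∧
      (1 - 2 * ε) ^ 2 * hEnergy N r ≤ C ∧
      Integrable (fun x => |u x - extendGrid N r x|) μT ∧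
      ∫ x, |u x - extendGrid N r x| ∂μT ≤ 2 * ε := by
  obtain ⟨m, hm, hwell⟩ := hW1.exists_near_wells hW hβ hε
  have hpow : Tendsto (fun n => (Nn n : ℝ) ^ α * m) atTop atTop :=
    (((tendsto_rpow_atTop (hβ.trans hα)).comp
      (tendsto_natCast_atTop_atTop.comp hNn))).atTop_mul_const hm
  obtain ⟨n, hlt, hNpos, hbig, hclose⟩ := (hC.and_eventually
    ((hNn.eventually_gt_atTop 0).and ((hpow.eventually_ge_atTop C).and
      (hconv.eventually_lt_const (ENNReal.ofReal_pos.2 hε))))).exists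
  simp only [hNalpha, iInf_lt_iff] at hlt
  obtain ⟨g, hrep, hE⟩ := hlt
  have hE : hAlphaEnergy W α (Nn n) g < C := (ENNReal.ofReal_lt_ofReal_iff'.1 hE).1
  have hg : ∀ i < Nn n, ∀ j < Nn n, |g i j - roundWell (g i j)| ≤ ε := fun i hi j hj => by
    refine abs_sub_roundWell_le hε' (hwell _ ?_)
    have hlt := ((rpow_mul_le_hAlphaEnergy hW.2.1 α hi hj g).trans_lt hE).trans_le hbig
    exact lt_of_mul_lt_mul_left hlt (by positivity)
  have hr : ∀ i j, |roundWell (g i j)| ≤ 1 := fun i j => abs_roundWell_le _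
  have hint := (hu.sub ((integrable_extendGrid_mul (N := Nn n) hr
    (continuous_const (y := (1 : ℝ)))))).abs
  simp only [mul_one] at hint
  refine ⟨Nn n, fun i j => roundWell (g i j), hNpos, fun i j => roundWell_eq _,
    (mul_hEnergy_roundWell_le hNpos hε' hg hW.2.1 α).trans hE.le, hint, ?_⟩
  have hUu : Integrable (fun x => |U n x - u x|) μT := ((hU n).sub hu).abs
  have hle : ∫ x, |U n x - u x| ∂μT ≤ ε := by
    rw [← ofReal_integral_eq_lintegral_ofReal hUu (ae_of_all _ fun _ => abs_nonneg _)] at hclose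
    exact (ENNReal.ofReal_lt_ofReal_iff'.1 hclose).1.le
  calc ∫ x, |u x - extendGrid (Nn n) (fun i j => roundWell (g i j)) x| ∂μT
      ≤ ∫ x, (|U n x - u x| + ε) ∂μT := by
        refine integral_mono_ae hint (hUu.add (integrable_const ε)) ?_
        filter_upwards [hrep] with x hx
        have h1 := hg _ (gridIdx_lt hNpos x.1) _ (gridIdx_lt hNpos x.2)
        change U n x = g _ _ at hx
        rw [← hx] at h1
        change |u x - roundWell (g _ _)| ≤ _
        rw [← hx, abs_sub_comm (U n x)]
        exact (abs_sub_le _ _ _).trans (add_le_add le_rfl h1)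
    _ = ∫ x, |U n x - u x| ∂μT + ε := by
        rw [integral_add hUu (integrable_const ε)]
        simp [Measure.real, μT_univ]
    _ ≤ 2 * ε := by linarith

/-- Lower bound (LB) for the simultaneous-scaling Γ-convergence `h_N^α → h_{∞,0}`:
under `(W1)` with exponent `β` and `α > β`, if `u_n → u` in `L¹(T²)` and `N_n → ∞` then
`h_{∞,0}(u) ≤ liminf_n h_{N_n}^α(u_n)`. -/
theorem lower_bound_hNalpha (W : ℝ → ℝ) (hW : DoubleWell W)
    (β : ℝ) (hβ : 0 < β) (hW1 : CondW1 W β) (α : ℝ) (hα : β < α)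
    (u : ℝ × ℝ → ℝ) (hu : Integrable u μT)
    (U : ℕ → ℝ × ℝ → ℝ) (hU : ∀ n, Integrable (U n) μT)
    (Nn : ℕ → ℕ) (hNn : Tendsto Nn atTop atTop) (hconv : TendstoL1 U u) :
    hInf0 u ≤ liminf (fun n => hNalpha W α (Nn n) (U n)) atTop := by
  refine le_of_forall_gt_imp_ge_of_dense fun c hc => ?_
  rcases eq_or_ne c ⊤ with rfl | hctop
  · exact le_top
  have hC : ∃ᶠ n in atTop, hNalpha W α (Nn n) (U n) < ENNReal.ofReal c.toReal := by
    rw [ENNReal.ofReal_toReal hctop]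
    exact frequently_lt_of_liminf_lt (by isBoundedDefault) hc
  have happrox : ∀ ε : ℝ, 0 < ε → ε < 1 / 2 → _ := fun ε hε hε' =>
    exists_binary_grid_approx hW hβ hW1 hα hu hU hNn hconv hC hε hε'
  have hsmall : ∀ᶠ ε : ℝ in 𝓝[>] 0, 0 < ε ∧ ε < 1 / 2 := Ioo_mem_nhdsGT (by norm_num)
  have hbin : ∀ᵐ x ∂μT, u x = 0 ∨ u x = 1 := by
    have hdint : Integrable (fun x => min |u x| |u x - 1|) μT :=
      hu.abs.inf (hu.sub (integrable_const 1)).abs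
    have hd0 : ∀ x, 0 ≤ min |u x| |u x - 1| := fun x => le_min (abs_nonneg _) (abs_nonneg _)
    have hdle : ∫ x, min |u x| |u x - 1| ∂μT ≤ 0 := by
      have hlim : Tendsto (fun ε : ℝ => 2 * ε) (𝓝[>] 0) (𝓝 0) :=
        tendsto_nhdsWithin_of_tendsto_nhds (Continuous.tendsto' (by fun_prop) _ _ (by simp))
      refine ge_of_tendsto hlim (hsmall.mono fun ε hε => ?_)
      obtain ⟨N, r, -, hr, -, hint, hle⟩ := happrox ε hε.1 hε.2
      refine (integral_mono hdint hint fun x => ?_).trans hle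
      change min |u x| |u x - 1| ≤ |u x - r _ _|
      rcases hr (gridIdx N x.1) (gridIdx N x.2) with h | h <;> simp [h]
    have h0 := (integral_eq_zero_iff_of_nonneg hd0 hdint).1
      (le_antisymm hdle (integral_nonneg hd0))
    filter_upwards [h0] with x hx
    rcases min_choice |u x| |u x - 1| with h | h
    · exact Or.inl (abs_eq_zero.1 (h ▸ hx))
    · exact Or.inr (sub_eq_zero.1 (abs_eq_zero.1 (h ▸ hx)))
  have haniso : anisoTV u ≤ c := by
    refine iSup₂_le fun v hv => ?_
    refine ENNReal.ofReal_le_of_le_toReal ?_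
    obtain ⟨hv1, hper, hb⟩ := hv
    obtain ⟨M, hM0, hM⟩ := exists_bound_of_continuous (continuous_div2 hv1)
    have hl : Tendsto (fun ε : ℝ => (1 - 2 * ε) ^ 2 * ∫ x, u x * div2 v x ∂μT) (𝓝[>] 0)
        (𝓝 (∫ x, u x * div2 v x ∂μT)) :=
      tendsto_nhdsWithin_of_tendsto_nhds (Continuous.tendsto' (by fun_prop) _ _ (by simp))
    have hr : Tendsto (fun ε : ℝ => c.toReal + M * (2 * ε)) (𝓝[>] 0) (𝓝 c.toReal) :=
      tendsto_nhdsWithin_of_tendsto_nhds (Continuous.tendsto' (by fun_prop) _ _ (by simp))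
    refine le_of_tendsto_of_tendsto hl hr (hsmall.mono fun ε hε => ?_)
    obtain ⟨N, r, hN, hr, hE, hint, hle⟩ := happrox ε hε.1 hε.2
    have hr1 : ∀ i j, |r i j| ≤ 1 := fun i j => by rcases hr i j with h | h <;> simp [h]
    have hw := integrable_extendGrid_mul (N := N) hr1 (continuous_div2 hv1)
    have hudiv : Integrable (fun x => u x * div2 v x) μT :=
      hu.mul_bdd (c := M) (continuous_div2 hv1).aestronglyMeasurable hM
    have hdiff : ∫ x, u x * div2 v x ∂μT - ∫ x, extendGrid N r x * div2 v x ∂μT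
        ≤ M * (2 * ε) := by
      rw [← integral_sub hudiv hw]
      refine le_trans ?_ (mul_le_mul_of_nonneg_left hle hM0)
      rw [← integral_const_mul]
      refine integral_mono_ae (hudiv.sub hw) (hint.const_mul M) ?_
      filter_upwards [hM] with x hx
      rw [← sub_mul, mul_comm M]
      refine (le_abs_self _).trans ?_
      rw [abs_mul]
      exact mul_le_mul_of_nonneg_left hx (abs_nonneg _)
    have hibp := integral_extendGrid_mul_div2_le hN hr1 hv1 hper hb
    have hsq : (1 - 2 * ε) ^ 2 ≤ 1 := by nlinarith [hε.1, hε.2]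
    calc (1 - 2 * ε) ^ 2 * ∫ x, u x * div2 v x ∂μT
        ≤ (1 - 2 * ε) ^ 2 * (hEnergy N r + M * (2 * ε)) :=
          mul_le_mul_of_nonneg_left (by linarith) (sq_nonneg _)
      _ ≤ c.toReal + M * (2 * ε) := by
          rw [mul_add]
          refine add_le_add hE (mul_le_of_le_one_left ?_ hsq)
          have := hε.1
          positivity
  have hBV : BV01 u := ⟨hu.aestronglyMeasurable, hbin,
    ((isoTV_le_anisoTV u).trans haniso).trans_lt hctop.lt_top⟩
  rw [hInf0, if_pos hBV]
  exact haniso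

end
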